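/- arXiv:1812.09147 — 7 statements merged into one kernel-verified Lean document; each statement's English description precedes it below -/
import Mathlib

section
/- Let K be a field, θ : K → K a ring homomorphism and ∂ : K → K a θ-derivation, and suppose it is not the case that both θ = id and ∂ = 0. Then there is at most one element c ∈ K for which the map x ↦ ∂(x) + c·θ(x) is of the form x ↦ a·x for some a ∈ F. Precisely: if c₁, c₂ ∈ K and a₁, a₂ ∈ F satisfy ∂(x) + c₁·θ(x) = a₁·x and ∂(x) + c₂·θ(x) = a₂·x for all x ∈ K, then c₁ = c₂. -/
/-- If `(θ, ∂) ≠ (id, 0)`, there is at most one `c ∈ K` for which `∂ + c·θ` is of the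
form `x ↦ a·x` with `a ∈ F = {a | θ a = a ∧ ∂ a = 0}`. -/
theorem at_most_one_bad_value {K : Type*} [Field K] (θ : K →+* K) (δ : K → K)
    (hδadd : ∀ a b : K, δ (a + b) = δ a + δ b)
    (hδmul : ∀ a b : K, δ (a * b) = θ a * δ b + δ a * b)
    (hnt : ¬ ((∀ x : K, θ x = x) ∧ (∀ x : K, δ x = 0)))
    (c₁ c₂ a₁ a₂ : K)
    (ha₁ : θ a₁ = a₁ ∧ δ a₁ = 0) (ha₂ : θ a₂ = a₂ ∧ δ a₂ = 0)
    (h₁ : ∀ x : K, δ x + c₁ * θ x = a₁ * x)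
    (h₂ : ∀ x : K, δ x + c₂ * θ x = a₂ * x) :
    c₁ = c₂ := by
  have hδ1 : δ 1 = 0 := by simpa using hδmul 1 1
  have e₁ : c₁ = a₁ := by simpa [hδ1] using h₁ 1
  have e₂ : c₂ = a₂ := by simpa [hδ1] using h₂ 1
  subst e₁ e₂
  by_contra hne
  have hθ : ∀ x : K, θ x = x := fun x =>
    mul_left_cancel₀ (sub_ne_zero.mpr hne) (by linear_combination h₁ x - h₂ x)
  refine hnt ⟨hθ, fun x => ?_⟩
  have hx := h₁ x
  rw [hθ] at hx
  linear_combination hx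
end

section
/- Let K be a field, θ : K → K a ring homomorphism, ∂ : K → K a θ-derivation, F the subfield {a ∈ K : θ(a) = a and ∂(a) = 0}, with K/F finite. Let c₁, c₂ ∈ K be good. Then the following are equivalent: (i) for every d ≥ 0 and every tuple (p₀, …, p_d) ∈ K^{d+1}, the map x ↦ Σ_{j=0}^{d} p_j·u_{c₁}^j(x) is identically zero on K if and only if the map x ↦ Σ_{j=0}^{d} p_j·u_{c₂}^j(x) is identically zero on K; (ii) there exists a nonzero a ∈ K such that c₁·a = c₂·θ(a) + ∂(a). -/
section SkewDerivation

variable {K : Type*} [Field K] {θ : K →+* K} {δ : K → K}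

lemma skewDerivation_mul_right
    (hδmul : ∀ a b : K, δ (a * b) = θ a * δ b + δ a * b) (c a x : K) :
    δ (a * x) + c * θ (a * x) = θ a * (δ x + c * θ x) + δ a * x := by
  rw [hδmul, map_mul]
  ring

/-- The pseudo-linear map `x ↦ δ x + c * θ x`, linear over a subfield of constants. -/
def pseudoLinear (hδadd : ∀ a b : K, δ (a + b) = δ a + δ b)
    (hδmul : ∀ a b : K, δ (a * b) = θ a * δ b + δ a * b)
    (F : Subfield K) (hF : ∀ a ∈ F, θ a = a ∧ δ a = 0) (c : K) : K →ₗ[F] K where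
  toFun x := δ x + c * θ x
  map_add' x y := by rw [hδadd, map_add]; ring
  map_smul' a x := by
    obtain ⟨h₁, h₂⟩ := hF a a.2
    simp only [Subfield.smul_def, smul_eq_mul, RingHom.id_apply]
    rw [skewDerivation_mul_right hδmul, h₁, h₂]
    ring

/-- A semilinear relation intertwines the two pseudo-linear maps. -/
lemma iterate_pseudoLinear_mul
    (hδmul : ∀ a b : K, δ (a * b) = θ a * δ b + δ a * b)
    {c₁ c₂ a : K} (h : c₁ * a = c₂ * θ a + δ a) (j : ℕ) (x : K) :
    (fun y => δ y + c₂ * θ y)^[j] (a * x) = a * (fun y => δ y + c₁ * θ y)^[j] x := by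
  have hs : Function.Semiconj (a * ·) (fun y => δ y + c₁ * θ y) (fun y => δ y + c₂ * θ y) := by
    intro y
    simp only
    rw [mul_comm a y, hδmul, map_mul]
    linear_combination θ y * h
  exact ((hs.iterate_right j).eq x).symm

/-- Eigenvectors with a common eigenvalue yield a semilinear relation. -/
lemma exists_relation_of_common_eigenvalue
    (hδmul : ∀ a b : K, δ (a * b) = θ a * δ b + δ a * b)
    {c₁ c₂ b s t : K} (hs : s ≠ 0) (ht : t ≠ 0)
    (h₁ : δ s + c₁ * θ s = b * s) (h₂ : δ t + c₂ * θ t = b * t) :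
    ∃ a : K, a ≠ 0 ∧ c₁ * a = c₂ * θ a + δ a := by
  obtain ⟨a, rfl⟩ : ∃ a, t = s * a := ⟨t / s, by field_simp⟩
  refine ⟨a, right_ne_zero_of_mul ht, ?_⟩
  rw [hδmul, map_mul] at h₂
  apply mul_left_cancel₀ ((map_ne_zero θ).2 hs)
  linear_combination a * h₁ - h₂

/-- In a finite-dimensional space with an additive pseudo-linear operator `U`, a nonzero
`U`-stable subspace contains a minimal one. -/
lemma exists_minimal_stable {V : Type*} [AddCommGroup V] [Module K V]
    [FiniteDimensional K V] (U : V → V) (M : Submodule K V) (hM : M ≠ ⊥)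
    (hMU : ∀ v ∈ M, U v ∈ M) :
    ∃ I ≤ M, I ≠ ⊥ ∧ (∀ v ∈ I, U v ∈ I) ∧
      ∀ J ≤ I, J ≠ ⊥ → (∀ v ∈ J, U v ∈ J) → J = I := by
  obtain ⟨I, ⟨hIM, hI, hIU⟩, hmin⟩ := IsArtinian.set_has_minimal
    {I : Submodule K V | I ≤ M ∧ I ≠ ⊥ ∧ ∀ v ∈ I, U v ∈ I} ⟨M, le_rfl, hM, hMU⟩
  refine ⟨I, hIM, hI, hIU, fun J hJI hJ hJU => ?_⟩
  by_contra hne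
  exact hmin J ⟨hJI.trans hIM, hJ, hJU⟩ (lt_of_le_of_ne hJI hne)

/-- If a linear functional on a minimal stable subspace has stable kernel and does not vanish
at `v`, then `v` is an eigenvector of `U`. -/
lemma exists_eigenvalue_of_minimal {V : Type*} [AddCommGroup V] [Module K V]
    {U : V → V} {I : Submodule K V} (hIU : ∀ v ∈ I, U v ∈ I)
    (hmin : ∀ J ≤ I, J ≠ ⊥ → (∀ v ∈ J, U v ∈ J) → J = I)
    (φ : V →ₗ[K] K) (hφ : ∀ v, φ v = 0 → φ (U v) = 0)
    {v : V} (hv : v ∈ I) (hφv : φ v ≠ 0) : ∃ b : K, U v = b • v := by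
  have hker : I ⊓ LinearMap.ker φ = ⊥ := by
    by_contra hne
    have h := hmin _ inf_le_left hne fun w hw => ⟨hIU w hw.1, hφ w hw.2⟩
    rw [← h] at hv
    exact hφv hv.2
  refine ⟨φ (U v) / φ v, sub_eq_zero.1 ?_⟩
  rw [← Submodule.mem_bot K, ← hker]
  refine ⟨I.sub_mem (hIU v hv) (I.smul_mem _ hv), ?_⟩
  simp [hφv]

lemma exists_sum_fin_of_mem_span_range {V : Type*} [AddCommGroup V] [Module K V]
    {w : ℕ → V} {v : V} (hv : v ∈ Submodule.span K (Set.range w)) :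
    ∃ (d : ℕ) (p : Fin (d + 1) → K), v = ∑ j : Fin (d + 1), p j • w j := by
  obtain ⟨c, rfl⟩ := Finsupp.mem_span_range_iff_exists_finsupp.1 hv
  refine ⟨c.support.sup id, fun j => c j, ?_⟩
  rw [← Finset.sum_range (fun j => c j • w j)]
  refine Finsupp.sum_of_support_subset _ (fun j hj => ?_) _ (by simp)
  exact Finset.mem_range.2 (Nat.lt_succ_of_le (Finset.le_sup (f := id) hj))

/-- The forward implication of `equivalent_iff`, which does not need goodness. -/
lemma exists_relation_of_same_vanishing (hδadd : ∀ a b : K, δ (a + b) = δ a + δ b)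
    (hδmul : ∀ a b : K, δ (a * b) = θ a * δ b + δ a * b)
    (F : Subfield K) (hF : ∀ a ∈ F, θ a = a ∧ δ a = 0) [FiniteDimensional F K] (c₁ c₂ : K)
    (h : ∀ (d : ℕ) (p : Fin (d + 1) → K),
      (∀ x : K, ∑ j : Fin (d + 1), p j * (fun y => δ y + c₁ * θ y)^[(j : ℕ)] x = 0) ↔
      (∀ x : K, ∑ j : Fin (d + 1), p j * (fun y => δ y + c₂ * θ y)^[(j : ℕ)] x = 0)) :
    ∃ a : K, a ≠ 0 ∧ c₁ * a = c₂ * θ a + δ a := by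
  let u (c : K) : K →ₗ[F] K := pseudoLinear hδadd hδmul F hF c
  have hu (c : K) (j : ℕ) : ⇑(u c ^ j) = (fun y => δ y + c * θ y)^[j] := Module.End.coe_pow _ _
  have hmul (c a x : K) : u c (a * x) = θ a * u c x + δ a * x :=
    skewDerivation_mul_right hδmul c a x
  have : FiniteDimensional K (K →ₗ[F] K) := Module.Finite.of_restrictScalars_finite F K _
  let U (v : (K →ₗ[F] K) × (K →ₗ[F] K)) : (K →ₗ[F] K) × (K →ₗ[F] K) :=
    (u c₁ ∘ₗ v.1, u c₂ ∘ₗ v.2)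
  let w (j : ℕ) : (K →ₗ[F] K) × (K →ₗ[F] K) := (u c₁ ^ j, u c₂ ^ j)
  let M := Submodule.span K (Set.range w)
  have hUw (j : ℕ) : U (w j) = w (j + 1) := by
    simp only [U, w, pow_succ', Module.End.mul_eq_comp]
  have hUadd (v v') : U (v + v') = U v + U v' := by
    simp [U, LinearMap.comp_add]
  have hUsmul (k : K) (v) : U (k • v) = θ k • U v + δ k • v := by
    refine Prod.ext (LinearMap.ext fun x => ?_) (LinearMap.ext fun x => ?_) <;>
      simp [U, hmul]
  have hMU : ∀ v ∈ M, U v ∈ M := by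
    intro v hv
    induction hv using Submodule.span_induction with
    | mem v hv =>
      obtain ⟨j, rfl⟩ := hv
      rw [hUw]
      exact Submodule.subset_span ⟨_, rfl⟩
    | zero =>
      have hU0 : U 0 = 0 := by simp [U]
      rw [hU0]
      exact M.zero_mem
    | add v v' _ _ hv hv' => rw [hUadd]; exact M.add_mem hv hv'
    | smul k v hv hUv =>
      rw [hUsmul]
      exact M.add_mem (M.smul_mem _ hUv) (M.smul_mem _ hv)
  have hM : M ≠ ⊥ := by
    refine (Submodule.ne_bot_iff _).2 ⟨w 0, Submodule.subset_span ⟨0, rfl⟩, fun h0 => ?_⟩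
    have := LinearMap.congr_fun (congrArg Prod.fst h0) (1 : K)
    simp [w] at this
  have hfg : ∀ v ∈ M, (v.1 = 0 ↔ v.2 = 0) := by
    intro v hv
    obtain ⟨d, p, rfl⟩ := exists_sum_fin_of_mem_span_range hv
    simpa [LinearMap.ext_iff, Prod.fst_sum, Prod.snd_sum, w, LinearMap.sum_apply, hu]
      using h d p
  obtain ⟨I, hIM, hI, hIU, hmin⟩ := exists_minimal_stable U M hM hMU
  obtain ⟨v, hv, hv0⟩ := (Submodule.ne_bot_iff _).1 hI
  have hv₁ : v.1 ≠ 0 := fun h0 => hv0 (Prod.ext h0 ((hfg v (hIM hv)).1 h0))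
  have hv₂ : v.2 ≠ 0 := fun h0 => hv₁ ((hfg v (hIM hv)).2 h0)
  obtain ⟨x, hx⟩ := DFunLike.ne_iff.1 hv₁
  obtain ⟨y, hy⟩ := DFunLike.ne_iff.1 hv₂
  let φ : (K →ₗ[F] K) × (K →ₗ[F] K) →ₗ[K] K :=
    { toFun := fun v => v.1 x
      map_add' := fun _ _ => rfl
      map_smul' := fun _ _ => rfl }
  obtain ⟨b, hb⟩ := exists_eigenvalue_of_minimal hIU hmin φ
    (fun v (hv : v.1 x = 0) => show u c₁ (v.1 x) = 0 by rw [hv, map_zero]) hv hx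
  exact exists_relation_of_common_eigenvalue hδmul hx hy
    (LinearMap.congr_fun (congrArg Prod.fst hb) x) (LinearMap.congr_fun (congrArg Prod.snd hb) y)

end SkewDerivation

/-- Two good elements `c₁, c₂` define the same kernel of evaluation (i.e. the same Ore
polynomials vanish identically under `u_{c₁}` and `u_{c₂}`) if and only if there is a
nonzero `a ∈ K` with `c₁·a = c₂·θ(a) + ∂(a)`. -/
theorem equivalent_iff {K : Type*} [Field K] (θ : K →+* K) (δ : K → K)
    (hδadd : ∀ a b : K, δ (a + b) = δ a + δ b)
    (hδmul : ∀ a b : K, δ (a * b) = θ a * δ b + δ a * b)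
    (F : Subfield K) (hF : ∀ a : K, a ∈ F ↔ θ a = a ∧ δ a = 0)
    [FiniteDimensional F K]
    (c₁ c₂ : K)
    (hc₁ : ¬ ∃ a ∈ F, ∀ x : K, δ x + c₁ * θ x = a * x)
    (hc₂ : ¬ ∃ a ∈ F, ∀ x : K, δ x + c₂ * θ x = a * x) :
    (∀ (d : ℕ) (p : Fin (d + 1) → K),
        (∀ x : K, ∑ j : Fin (d + 1), p j * (fun y => δ y + c₁ * θ y)^[(j : ℕ)] x = 0) ↔
        (∀ x : K, ∑ j : Fin (d + 1), p j * (fun y => δ y + c₂ * θ y)^[(j : ℕ)] x = 0)) ↔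
      ∃ a : K, a ≠ 0 ∧ c₁ * a = c₂ * θ a + δ a := by
  refine ⟨exists_relation_of_same_vanishing hδadd hδmul F (fun a => (hF a).1) c₁ c₂, ?_⟩
  rintro ⟨a, ha, h⟩ d p
  have key (x : K) : ∑ j : Fin (d + 1), p j * (fun y => δ y + c₂ * θ y)^[(j : ℕ)] (a * x) =
      a * ∑ j : Fin (d + 1), p j * (fun y => δ y + c₁ * θ y)^[(j : ℕ)] x := by
    rw [Finset.mul_sum]
    refine Finset.sum_congr rfl fun j _ => ?_
    rw [iterate_pseudoLinear_mul hδmul h]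
    ring
  refine ⟨fun h₁ x => ?_, fun h₂ x => ?_⟩
  · rw [← mul_div_cancel₀ x ha, key, h₁, mul_zero]
  · exact (mul_eq_zero.1 ((key x).symm.trans (h₂ _))).resolve_left ha
end

section
/- Let q be a prime power and m ≥ 1, and consider the finite field 𝔽_{q^m}. Define a relation on the nonzero elements of 𝔽_{q^m} by c₁ ∼ c₂ if and only if there exists a nonzero a ∈ 𝔽_{q^m} with c₁·a = c₂·a^q. Then ∼ is an equivalence relation and it has exactly q − 1 equivalence classes. -/
/-- The Frobenius twist relation on units is left-coset equivalence modulo `(n - 1)`-th powers. -/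
theorem frobenius_twist_iff_leftRel {K : Type*} [Field K] {n : ℕ} (hn : 0 < n) (c₁ c₂ : Kˣ) :
    (∃ a : Kˣ, (c₁ : K) * (a : K) = (c₂ : K) * (a : K) ^ n) ↔
      QuotientGroup.leftRel (powMonoidHom (α := Kˣ) (n - 1)).range c₁ c₂ := by
  obtain ⟨k, rfl⟩ := Nat.exists_eq_add_one.mpr hn
  rw [QuotientGroup.leftRel_apply, ← inv_mem_iff, mul_inv_rev, inv_inv, MonoidHom.mem_range]
  refine exists_congr fun a => ?_
  rw [powMonoidHom_apply, Nat.add_sub_cancel, eq_inv_mul_iff_mul_eq, ← Units.val_mul,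
    ← Units.val_pow_eq_pow_val, ← Units.val_mul, Units.val_inj, pow_succ, ← mul_assoc,
    mul_left_inj, eq_comm]

/-- On the nonzero elements of a finite field with `q^m` elements, the relation
`c₁ ∼ c₂ ↔ ∃ a ≠ 0, c₁·a = c₂·a^q` is an equivalence relation with exactly `q - 1`
equivalence classes. -/
theorem frobenius_twist_classes (q m : ℕ) (hq : IsPrimePow q) (hm : 0 < m)
    (K : Type*) [Field K] [Fintype K] (hcard : Fintype.card K = q ^ m) :
    Equivalence (fun c₁ c₂ : Kˣ => ∃ a : Kˣ, (c₁ : K) * (a : K) = (c₂ : K) * (a : K) ^ q) ∧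
    Nat.card (Quot (fun c₁ c₂ : Kˣ =>
        ∃ a : Kˣ, (c₁ : K) * (a : K) = (c₂ : K) * (a : K) ^ q)) = q - 1 := by
  have hrel : (fun c₁ c₂ : Kˣ => ∃ a : Kˣ, (c₁ : K) * (a : K) = (c₂ : K) * (a : K) ^ q) =
      QuotientGroup.leftRel (powMonoidHom (α := Kˣ) (q - 1)).range :=
    funext₂ fun c₁ c₂ => propext (frobenius_twist_iff_leftRel hq.pos c₁ c₂)
  rw [hrel]
  refine ⟨(QuotientGroup.leftRel _).iseqv, ?_⟩
  change (powMonoidHom (α := Kˣ) (q - 1)).range.index = q - 1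
  rw [IsCyclic.index_powMonoidHom_range, Nat.card_units, Nat.card_eq_fintype_card, hcard]
  exact Nat.gcd_eq_right (Nat.sub_one_dvd_pow_sub_one q m)
end

section
/- Let κ be a field of characteristic p > 0 and let K = κ(t) be the field of rational functions over κ, equipped with the derivation d/dt. For f ∈ κ(t), let u_f : κ(t) → κ(t) be the map x ↦ x' + f·x, where x' denotes the derivative of x. Then the p-fold iterate of u_f equals multiplication by N(f) := f^{(p−1)} + f^p, where f^{(p−1)} denotes the (p−1)-fold derivative of f; that is, u_f^p(x) = (f^{(p−1)} + f^p)·x for all x ∈ κ(t). -/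
open Finset in
/-- Generalized Leibniz rule for iterates of an additive map `u` which is twisted over `D`. -/
theorem iterate_mul_eq_sum_antidiagonal {R : Type*} [CommRing R] (D u : R → R)
    (hadd : ∀ y z, u (y + z) = u y + u z) (hmul : ∀ y z, u (y * z) = D y * z + y * u z)
    (n : ℕ) (x z : R) :
    u^[n] (x * z) = ∑ ij ∈ antidiagonal n, (n.choose ij.1 : R) * (D^[ij.1] x * u^[ij.2] z) := by
  let v : R →+ R := AddMonoidHom.mk' u hadd
  have hv : ∀ y, u y = v y := fun _ => rfl
  induction n with
  | zero => simp
  | succ n ih =>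
    rw [sum_antidiagonal_choose_succ_mul (fun i j => D^[i] x * u^[j] z),
      Function.iterate_succ_apply', ih, hv, map_sum, ← sum_add_distrib]
    refine sum_congr rfl fun ij hij => ?_
    rw [← nsmul_eq_mul, map_nsmul, ← hv, hmul, Function.iterate_succ_apply',
      Function.iterate_succ_apply', Nat.choose_symm_of_eq_add (mem_antidiagonal.1 hij).symm]
    simp only [nsmul_eq_mul]
    ring

open Finset in
/-- In characteristic `p`, the `p`-th iterate of a twisted additive map satisfies the Leibniz rule
without intermediate terms. -/
theorem iterate_char_mul {R : Type*} [CommRing R] (p : ℕ) [hp : Fact p.Prime] [CharP R p]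
    (D u : R → R)
    (hadd : ∀ y z, u (y + z) = u y + u z) (hmul : ∀ y z, u (y * z) = D y * z + y * u z)
    (x z : R) :
    u^[p] (x * z) = D^[p] x * z + x * u^[p] z := by
  obtain ⟨m, rfl⟩ : ∃ m, p = m + 2 := ⟨p - 2, by have := hp.out.two_le; omega⟩
  rw [iterate_mul_eq_sum_antidiagonal D u hadd hmul, Nat.sum_antidiagonal_succ,
    Nat.sum_antidiagonal_succ', sum_eq_zero]
  · simp; ring
  · intro ij hij
    rw [HasAntidiagonal.mem_antidiagonal] at hij
    rw [(CharP.cast_eq_zero_iff R (m + 2) _).2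
      (hp.out.dvd_choose_self (by simp) (by simp only; omega)), zero_mul]

open Finset in
/-- If `E` is a derivation-like additive map with `[E, u] = f` and `E 1 = 0`, then `E (uⁿ 1)`
expands in terms of the iterated derivatives of `f`. -/
theorem apply_iterate_one_eq_sum {R : Type*} [CommRing R] (D u E : R → R) (f : R)
    (hadd : ∀ y z, u (y + z) = u y + u z) (hmul : ∀ y z, u (y * z) = D y * z + y * u z)
    (hE : E 1 = 0) (hcomm : ∀ y, E (u y) = f * y + u (E y)) (n : ℕ) :
    E (u^[n + 1] 1) =
      ∑ ij ∈ antidiagonal n, ((n + 1).choose (ij.1 + 1) : R) * (D^[ij.1] f * u^[ij.2] 1) := by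
  let v : R →+ R := AddMonoidHom.mk' u hadd
  have hv : ∀ y, u y = v y := fun _ => rfl
  induction n with
  | zero => simp [hcomm, hE, show u 0 = 0 from map_zero v]
  | succ n ih =>
    have key : ∑ ij ∈ antidiagonal (n + 1),
        ((n + 1).choose (ij.1 + 1) : R) * (D^[ij.1] f * u^[ij.2] 1) =
        ∑ ij ∈ antidiagonal n,
          ((n + 1).choose (ij.1 + 1) : R) * (D^[ij.1] f * u^[ij.2 + 1] 1) := by
      rw [Nat.sum_antidiagonal_succ']
      simp
    simp only [Nat.choose_succ_succ (n + 1), Nat.cast_add, add_mul, sum_add_distrib]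
    rw [key, Nat.sum_antidiagonal_succ, Function.iterate_succ_apply', hcomm, ih, hv, map_sum,
      add_assoc, ← sum_add_distrib]
    congr 1
    · simp
    · refine sum_congr rfl fun ij _ => ?_
      rw [← nsmul_eq_mul, map_nsmul, ← hv, hmul, Function.iterate_succ_apply',
        Function.iterate_succ_apply']
      simp only [nsmul_eq_mul]
      ring

open Finset in
/-- In characteristic `p`, if `[E, u] = f` and `E 1 = 0` then `E (uᵖ 1) = D^{p-1} f`. -/
theorem apply_iterate_char_one {R : Type*} [CommRing R] (p : ℕ) [hp : Fact p.Prime] [CharP R p]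
    (D u E : R → R) (f : R)
    (hadd : ∀ y z, u (y + z) = u y + u z) (hmul : ∀ y z, u (y * z) = D y * z + y * u z)
    (hE : E 1 = 0) (hcomm : ∀ y, E (u y) = f * y + u (E y)) :
    E (u^[p] 1) = D^[p - 1] f := by
  obtain ⟨m, rfl⟩ : ∃ m, p = m + 2 := ⟨p - 2, by have := hp.out.two_le; omega⟩
  rw [apply_iterate_one_eq_sum D u E f hadd hmul hE hcomm, Nat.sum_antidiagonal_succ',
    sum_eq_zero]
  · simp
  · intro ij hij
    rw [HasAntidiagonal.mem_antidiagonal] at hij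
    rw [(CharP.cast_eq_zero_iff R (m + 2) _).2
      (hp.out.dvd_choose_self (by simp) (by simp only; omega)), zero_mul]

open Polynomial in
/-- Jacobson's formula for the `p`-th iterate of `D + f` applied to `1`. -/
theorem Derivation.iterate_add_mul_one {A R : Type*} [CommRing A] [CommRing R]
    [Algebra A R] (p : ℕ) [hp : Fact p.Prime] [CharP R p] (D : Derivation A R R) (f : R) :
    (fun y => D y + f * y)^[p] 1 = D^[p - 1] f + f ^ p := by
  let _ : Differential R := ⟨D.restrictScalars ℤ⟩
  let Δ : Derivation ℤ R[X] R[X] := Differential.mapCoeffs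
  have hΔ (q : R[X]) (i : ℕ) : (Δ q).coeff i = D (q.coeff i) := Differential.coeff_mapCoeffs q i
  let u : R[X] → R[X] := fun y => Δ y + X * C f * y
  have hu (q : R[X]) (i : ℕ) : (u q).coeff (i + 1) = D (q.coeff (i + 1)) + f * q.coeff i := by
    simp [u, hΔ, mul_assoc, coeff_X_mul]
  have hu0 (q : R[X]) : (u q).coeff 0 = D (q.coeff 0) := by
    simp [u, hΔ, mul_assoc]
  have hdeg (n : ℕ) : (u^[n] 1).natDegree ≤ n ∧ (u^[n] 1).coeff n = f ^ n := by
    induction n with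
    | zero => simp
    | succ n ih =>
      rw [natDegree_le_iff_coeff_eq_zero] at ih ⊢
      rw [Function.iterate_succ_apply']
      refine ⟨fun N hN => ?_, ?_⟩
      · obtain ⟨N, rfl⟩ : ∃ k, N = k + 1 := ⟨N - 1, by omega⟩
        rw [hu, ih.1 _ (by omega), ih.1 _ (by omega)]
        simp
      · rw [hu, ih.1 _ (by omega), ih.2]
        simp [pow_succ']
  have hzero (n : ℕ) : (u^[n + 1] 1).coeff 0 = 0 := by
    induction n with
    | zero => simp [hu0]
    | succ n ih => rw [Function.iterate_succ_apply', hu0, ih, map_zero]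
  have heval (n : ℕ) : (u^[n] 1).eval 1 = (fun y => D y + f * y)^[n] 1 := by
    have hev (q : R[X]) : (Δ q).eval 1 = D (q.eval 1) := by
      induction q using Polynomial.induction_on' with
      | add a b ha hb => simp [ha, hb]
      | monomial k a =>
        have : Δ (monomial k a) = monomial k (D a) := by
          ext i
          rw [hΔ, coeff_monomial, coeff_monomial]
          split_ifs <;> simp
        simp [this]
    induction n with
    | zero => simp
    | succ n ih =>
      rw [Function.iterate_succ_apply', Function.iterate_succ_apply', ← ih]
      simp [u, hev]
  have hder : derivative (u^[p] 1) = C (D^[p - 1] f) := by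
    have h := apply_iterate_char_one p (fun y => Δ y) u (fun y => derivative y) (C f)
      (fun y z => by simp only [u, map_add]; ring)
      (fun y z => by simp only [u, Derivation.leibniz, smul_eq_mul]; ring) derivative_one
      (fun y => by
        have : derivative (Δ y) = Δ (derivative y) := by
          ext i
          simp only [coeff_derivative, hΔ, Derivation.leibniz]
          have : D ((i : R) + 1) = 0 := by simp
          rw [this]
          simp [mul_comm]
        simp only [u, derivative_add, derivative_mul, derivative_X, derivative_C, this]
        ring)
    rw [h]
    refine Function.Semiconj.iterate_right (f := C) ?_ (p - 1) f |>.symm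
    intro a
    ext i
    rw [hΔ, coeff_C, coeff_C]
    split_ifs <;> simp
  obtain ⟨m, rfl⟩ : ∃ m, p = m + 2 := ⟨p - 2, by have := hp.out.two_le; omega⟩
  have hmid (j : ℕ) (hj : j < m) : (u^[m + 2] 1).coeff (j + 1 + 1) = 0 := by
    have h := congrArg (fun q => q.coeff (j + 1)) hder
    simp only [coeff_derivative, coeff_C, Nat.succ_ne_zero, if_false] at h
    have hunit : IsUnit ((j + 1 + 1 : ℕ) : R) :=
      (CharP.isUnit_natCast_iff hp.out).2 (Nat.not_dvd_of_pos_of_lt (by omega) (by omega))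
    rw [← hunit.mul_left_eq_zero]
    exact_mod_cast h
  have hone : (u^[m + 2] 1).coeff 1 = D^[m + 2 - 1] f := by
    have h := congrArg (fun q => q.coeff 0) hder
    simpa [coeff_derivative] using h
  rw [← heval, eval_eq_sum_range' (Nat.lt_succ_of_le (hdeg (m + 2)).1), Finset.sum_range_succ,
    Finset.sum_range_succ', Finset.sum_range_succ', Finset.sum_eq_zero]
  · rw [hzero, (hdeg _).2, zero_add, hone]
    simp
  · intro j hj
    rw [hmid j (Finset.mem_range.1 hj), zero_mul]

open Polynomial in
/-- The `p`-th iterate of the standard derivation of `κ(t)` vanishes in characteristic `p`. -/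
theorem RatFunc.iterate_char_derivation_eq_zero {κ : Type*} [Field κ] (p : ℕ) [hp : Fact p.Prime]
    [CharP κ p] (D : Derivation κ (RatFunc κ) (RatFunc κ)) (hD : D RatFunc.X = 1)
    (x : RatFunc κ) : D^[p] x = 0 := by
  have : CharP (RatFunc κ) p := charP_of_injective_algebraMap
    (algebraMap κ (RatFunc κ)).injective p
  have hmul (y z : RatFunc κ) : D^[p] (y * z) = D^[p] y * z + y * D^[p] z :=
    iterate_char_mul p D D (map_add D)
      (fun y z => by rw [Derivation.leibniz]; simp only [smul_eq_mul]; ring) y z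
  have hzero (n : ℕ) : D^[n] 0 = 0 := Function.iterate_fixed (map_zero D) n
  have hX : D^[p] RatFunc.X = 0 := by
    obtain ⟨m, rfl⟩ : ∃ m, p = m + 2 := ⟨p - 2, by have := hp.out.two_le; omega⟩
    rw [Function.iterate_succ_apply, hD, Function.iterate_succ_apply, Derivation.map_one_eq_zero,
      hzero]
  have hC (a : κ) : D^[p] (algebraMap κ _ a) = 0 := by
    obtain ⟨m, rfl⟩ : ∃ m, p = m + 1 := ⟨p - 1, by have := hp.out.two_le; omega⟩
    rw [Function.iterate_succ_apply, Derivation.map_algebraMap, hzero]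
  have hXpow (n : ℕ) : D^[p] (RatFunc.X ^ n) = 0 := by
    induction n with
    | zero => simpa using hC 1
    | succ n ih => rw [pow_succ, hmul, ih, hX]; simp
  have hpoly (q : κ[X]) : D^[p] (algebraMap κ[X] (RatFunc κ) q) = 0 := by
    induction q using Polynomial.induction_on' with
    | add a b ha hb => rw [map_add, iterate_map_add, ha, hb, add_zero]
    | monomial n a =>
      rw [← C_mul_X_pow_eq_monomial, map_mul, map_pow, RatFunc.algebraMap_C, RatFunc.algebraMap_X,
        hmul, hXpow, ← RatFunc.algebraMap_eq_C, hC]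
      simp
  have hd : algebraMap κ[X] (RatFunc κ) x.denom ≠ 0 := RatFunc.algebraMap_ne_zero x.denom_ne_zero
  have h := hmul x (algebraMap _ _ x.denom)
  have hx : x * algebraMap κ[X] (RatFunc κ) x.denom = algebraMap _ _ x.num := by
    rw [← eq_div_iff hd, RatFunc.num_div_denom]
  rw [hx, hpoly, hpoly, mul_zero, add_zero] at h
  exact (mul_eq_zero.1 h.symm).resolve_right hd

/-- Over `κ(t)` with `κ` of characteristic `p`, for `u_f : x ↦ x' + f·x` the `p`-fold
iterate of `u_f` is multiplication by `N(f) = f^{(p-1)} + f^p`. -/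
theorem iterate_eq_mul_N (κ : Type*) [Field κ] (p : ℕ) [hp : Fact p.Prime] [CharP κ p]
    (D : Derivation κ (RatFunc κ) (RatFunc κ)) (hD : D RatFunc.X = 1)
    (f : RatFunc κ) :
    ∀ x : RatFunc κ, (fun y => D y + f * y)^[p] x = ((⇑D)^[p - 1] f + f ^ p) * x := by
  intro x
  have : CharP (RatFunc κ) p := charP_of_injective_algebraMap
    (algebraMap κ (RatFunc κ)).injective p
  have h := iterate_char_mul p D (fun y => D y + f * y)
    (fun y z => by simp only [map_add]; ring)
    (fun y z => by simp only [Derivation.leibniz, smul_eq_mul]; ring) x 1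
  have h1 := Derivation.iterate_add_mul_one p D f
  rw [mul_one, RatFunc.iterate_char_derivation_eq_zero p D hD, zero_mul, zero_add] at h
  rw [h, mul_comm]
  exact congrArg (· * x) h1
end

section
/- Let κ be a field of characteristic p > 0 and κ(t) the field of rational functions over κ. No nonzero polynomial is a logarithmic derivative in κ(t): if a ∈ κ(t) is nonzero and f ∈ κ[t] is a polynomial satisfying a' = f·a (i.e. f = a'/a), then f = 0. Equivalently, there is no nonzero rational function a ∈ κ(t) and nonzero polynomial f ∈ κ[t] with a'/a = f. -/
open Polynomial in
theorem Derivation.ratFunc_algebraMap {κ : Type*} [Field κ]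
    (D : Derivation κ (RatFunc κ) (RatFunc κ)) (hD : D RatFunc.X = 1) (q : κ[X]) :
    D (algebraMap κ[X] (RatFunc κ) q) = algebraMap κ[X] (RatFunc κ) (derivative q) := by
  have aeval_eq (f : κ[X]) : aeval (RatFunc.X : RatFunc κ) f = algebraMap κ[X] (RatFunc κ) f := by
    rw [← RatFunc.algebraMap_X, aeval_algebraMap_apply, aeval_X_left_apply]
  rw [← aeval_eq, Derivation.map_aeval, hD, aeval_eq, smul_eq_mul, mul_one]

open Polynomial in
theorem Polynomial.eq_zero_of_mul_derivative_sub_eq {R : Type*} [CommRing R] [IsDomain R]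
    {u v g : R[X]} (hu : u ≠ 0) (hv : v ≠ 0)
    (h : v * derivative u - u * derivative v = g * (u * v)) : g = 0 := by
  by_contra hg
  have huv : u * v ≠ 0 := mul_ne_zero hu hv
  have h₁ : (v * derivative u).degree < (u * v).degree := by
    rw [mul_comm u, degree_mul, degree_mul]
    exact WithBot.add_lt_add_left (degree_ne_bot.2 hv) (degree_derivative_lt hu)
  have h₂ : (u * derivative v).degree < (u * v).degree := by
    rw [degree_mul, degree_mul]
    exact WithBot.add_lt_add_left (degree_ne_bot.2 hu) (degree_derivative_lt hv)
  have h₃ : (g * (u * v)).degree < (u * v).degree :=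
    h ▸ (degree_sub_le _ _).trans_lt (max_lt h₁ h₂)
  exact h₃.not_ge (mul_comm g (u * v) ▸ degree_le_mul_left _ hg)


/-- No nonzero polynomial is a logarithmic derivative in `κ(t)`: if `a ∈ κ(t)` is nonzero
and `g ∈ κ[t]` satisfies `a' = g·a`, then `g = 0`. -/
theorem polynomial_not_logarithmic_derivative (κ : Type*) [Field κ] (p : ℕ)
    [hp : Fact p.Prime] [CharP κ p]
    (D : Derivation κ (RatFunc κ) (RatFunc κ)) (hD : D RatFunc.X = 1)
    (a : RatFunc κ) (ha : a ≠ 0) (g : Polynomial κ)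
    (h : D a = algebraMap (Polynomial κ) (RatFunc κ) g * a) :
    g = 0 := by
  have hv : algebraMap (Polynomial κ) (RatFunc κ) a.denom ≠ 0 :=
    RatFunc.algebraMap_ne_zero a.denom_ne_zero
  have hav : algebraMap (Polynomial κ) (RatFunc κ) a.num =
      a * algebraMap (Polynomial κ) (RatFunc κ) a.denom :=
    (div_eq_iff hv).1 a.num_div_denom
  have hD' := congrArg D hav
  rw [D.leibniz, h, D.ratFunc_algebraMap hD, D.ratFunc_algebraMap hD, smul_eq_mul,
    smul_eq_mul] at hD'
  refine Polynomial.eq_zero_of_mul_derivative_sub_eq (RatFunc.num_ne_zero ha) a.denom_ne_zero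
    (RatFunc.algebraMap_injective κ ?_)
  rw [map_sub, map_mul, map_mul, map_mul, map_mul, hD', hav]
  ring
end

section
/- Let κ be a field of characteristic p > 0 and κ(t) the field of rational functions over κ. For every nonzero a ∈ κ(t), the logarithmic derivative h = a'/a satisfies h^{(p−1)} + h^p = 0, where h^{(p−1)} denotes the (p−1)-fold derivative of h. In other words, the function N(f) = f^{(p−1)} + f^p vanishes on all logarithmic derivatives. -/
open Polynomial in
theorem iterate_derivative_pow_char_mul {R : Type*} [CommRing R] (p : ℕ) [CharP R p]
    (n : ℕ) (a b : R[X]) :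
    derivative^[n] (a ^ p * b) = a ^ p * derivative^[n] b := by
  induction n with
  | zero => rfl
  | succ n ih =>
    rw [Function.iterate_succ_apply', ih, Function.iterate_succ_apply', derivative_mul,
      derivative_pow, CharP.cast_eq_zero]
    simp

open Polynomial in
/-- For split polynomials over a field of characteristic `p`, the `(p-1)`-st derivative of
`a^(p-1) a'` is `-(a')^p`. -/
theorem Polynomial.Splits.iterate_derivative_pow_mul_derivative {K : Type*} [Field K] (p : ℕ)
    [hp : Fact p.Prime] [CharP K p] {a : K[X]} (ha : a.Splits) :
    derivative^[p - 1] (a ^ (p - 1) * derivative a) + derivative a ^ p = 0 := by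
  have hp1 : p - 1 + 1 = p := Nat.sub_add_cancel hp.out.one_le
  induction ha using Submonoid.closure_induction with
  | one => simp [hp.out.ne_zero]
  | mem a ha =>
    rcases ha with ⟨c, rfl⟩ | ⟨c, rfl⟩
    · simp [hp.out.ne_zero]
    · have hw : ((p - 1).factorial : K) = -1 := by
        have h := congrArg (ZMod.castHom (dvd_refl p) K) (ZMod.wilsons_lemma p)
        rwa [map_natCast, map_neg, map_one] at h
      have hw' : ((p - 1).factorial : K[X]) = -1 := by
        simpa using congrArg (C : K → K[X]) hw
      simp [iterate_derivative_X_add_pow, Nat.descFactorial_self, hw']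
  | mul a b _ _ iha ihb =>
    have e : (a * b) ^ (p - 1) * derivative (a * b) =
        b ^ p * (a ^ (p - 1) * derivative a) + a ^ p * (b ^ (p - 1) * derivative b) := by
      conv_rhs => rw [← hp1]
      rw [derivative_mul, Nat.add_sub_cancel]
      ring
    have : ExpChar K[X] p := ExpChar.prime hp.out
    rw [e, iterate_map_add, iterate_derivative_pow_char_mul p,
      iterate_derivative_pow_char_mul p, derivative_mul, add_pow_expChar, mul_pow, mul_pow]
    linear_combination b ^ p * iha + a ^ p * ihb

open Polynomial in
/-- Over a field of characteristic `p`, the `(p-1)`-st derivative of `a^(p-1) a'` is `-(a')^p`. -/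
theorem Polynomial.iterate_derivative_pow_mul_derivative {K : Type*} [Field K] (p : ℕ)
    [Fact p.Prime] [CharP K p] (a : K[X]) :
    derivative^[p - 1] (a ^ (p - 1) * derivative a) + derivative a ^ p = 0 := by
  have : CharP (AlgebraicClosure K) p := charP_of_injective_algebraMap' K p
  apply map_injective _ (algebraMap K (AlgebraicClosure K)).injective
  have h := (IsAlgClosed.splits
    (a.map (algebraMap K (AlgebraicClosure K)))).iterate_derivative_pow_mul_derivative p
  simpa [← iterate_derivative_map, derivative_map] using h

theorem Derivation.iterate_div_of_map_eq_zero {R K : Type*} [CommRing R] [Field K] [Algebra R K]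
    (D : Derivation R K K) {c : K} (hc : D c = 0) (n : ℕ) (x : K) :
    (⇑D)^[n] (x / c) = (⇑D)^[n] x / c := by
  induction n with
  | zero => rfl
  | succ n ih =>
    rw [Function.iterate_succ_apply', ih, Function.iterate_succ_apply', D.leibniz_div_const _ _ hc,
      smul_eq_mul, inv_mul_eq_div]

theorem Derivation.pow_char_eq_zero {R K : Type*} [CommRing R] [Field K] [Algebra R K]
    (D : Derivation R K K) (p : ℕ) [CharP K p] (x : K) : D (x ^ p) = 0 := by
  rw [D.leibniz_pow, ← Nat.cast_smul_eq_nsmul K, CharP.cast_eq_zero, zero_smul]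

open Polynomial in
theorem RatFunc.derivation_algebraMap {K : Type*} [Field K]
    (D : Derivation K (RatFunc K) (RatFunc K)) (hD : D RatFunc.X = 1) (f : K[X]) :
    D (algebraMap K[X] (RatFunc K) f) = algebraMap K[X] (RatFunc K) (derivative f) := by
  have hf (f : K[X]) : algebraMap K[X] (RatFunc K) f = aeval RatFunc.X f := by
    rw [← RatFunc.algebraMap_X, aeval_algebraMap_apply, aeval_X_left_apply]
  rw [hf, hf, D.map_aeval, hD, smul_eq_mul, mul_one]

open Polynomial in
/-- In `κ(t)` with `κ` of characteristic `p`, every logarithmic derivative `h = a'/a`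
satisfies `h^{(p-1)} + h^p = 0`. -/
theorem N_vanishes_on_logarithmic_derivatives (κ : Type*) [Field κ] (p : ℕ)
    [hp : Fact p.Prime] [CharP κ p]
    (D : Derivation κ (RatFunc κ) (RatFunc κ)) (hD : D RatFunc.X = 1)
    (a : RatFunc κ) (ha : a ≠ 0) :
    (⇑D)^[p - 1] (D a / a) + (D a / a) ^ p = 0 := by
  have : CharP (RatFunc κ) p := charP_of_injective_algebraMap' κ p
  have hp1 : p - 1 + 1 = p := Nat.sub_add_cancel hp.out.one_le
  obtain ⟨f, g, hg, rfl⟩ := IsFractionRing.div_surjective (A := κ[X]) a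
  have hg0 : algebraMap κ[X] (RatFunc κ) g ≠ 0 := fun h => ha (by rw [h, div_zero])
  have hf0 : algebraMap κ[X] (RatFunc κ) f ≠ 0 := fun h => ha (by rw [h, zero_div])
  set φ := algebraMap κ[X] (RatFunc κ)
  obtain ⟨F, hF⟩ : ∃ F, F = f * g ^ (p - 1) := ⟨_, rfl⟩
  have hF0 : φ F ≠ 0 := by
    rw [hF, map_mul, map_pow]
    exact mul_ne_zero hf0 (pow_ne_zero _ hg0)
  have hfg : φ f / φ g = φ F / φ g ^ p := by
    rw [hF, map_mul, map_pow, div_eq_div_iff hg0 (pow_ne_zero _ hg0), mul_assoc, ← pow_succ, hp1]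
  have hlog : D (φ f / φ g) / (φ f / φ g) = φ (derivative F) / φ F := by
    rw [hfg, D.leibniz_div_const _ _ (D.pow_char_eq_zero p _), RatFunc.derivation_algebraMap D hD,
      smul_eq_mul, inv_mul_eq_div, div_div_div_cancel_right₀ (pow_ne_zero _ hg0)]
  have hpow : φ (derivative F) / φ F = φ (F ^ (p - 1) * derivative F) / φ F ^ p := by
    rw [map_mul φ, map_pow φ, div_eq_div_iff hF0 (pow_ne_zero _ hF0)]
    conv_lhs => rw [← hp1, pow_succ]
    ring
  have hsemi : Function.Semiconj φ derivative D :=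
    fun q => (RatFunc.derivation_algebraMap D hD q).symm
  rw [hlog, div_pow, hpow, D.iterate_div_of_map_eq_zero (D.pow_char_eq_zero p _),
    ← hsemi.iterate_right (p - 1), ← add_div, ← map_pow φ, ← map_add φ,
    iterate_derivative_pow_mul_derivative, map_zero, zero_div]
end

section
/- Let q be a prime power, r ≥ 1, and let g be a generator of the multiplicative group of the finite field 𝔽_{q^r}. Then the elements 1, g, g², …, g^{q−2} are pairwise nonequivalent for the Frobenius twist relation: for all 0 ≤ i < j ≤ q − 2 there is no nonzero a ∈ 𝔽_{q^r} with g^i·a = g^j·a^q. -/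
/-- If `g` generates the multiplicative group of a finite field with `q^r` elements, then
`1, g, g², …, g^{q-2}` are pairwise nonequivalent for the Frobenius twist relation: for
`0 ≤ i < j ≤ q - 2`, there is no nonzero `a` with `g^i·a = g^j·a^q`. -/
theorem powers_pairwise_nonequivalent (q r : ℕ) (hq : IsPrimePow q) (hr : 1 ≤ r)
    (K : Type*) [Field K] [Fintype K] (hcard : Fintype.card K = q ^ r)
    (g : Kˣ) (hg : ∀ u : Kˣ, u ∈ Subgroup.zpowers g)
    (i j : ℕ) (hij : i < j) (hj : j ≤ q - 2) :
    ¬ ∃ a : K, a ≠ 0 ∧ (g : K) ^ i * a = (g : K) ^ j * a ^ q := by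
  rintro ⟨a, ha, h⟩
  have hq2 : 2 ≤ q := hq.two_le
  obtain ⟨k, hk⟩ := mem_powers_iff_mem_zpowers.2 (hg (Units.mk0 a ha))
  have hka : (g : K) ^ k = a := by
    simpa using congrArg Units.val hk
  have hpow : g ^ (i + k) = g ^ (j + k * q) := by
    ext
    push_cast
    rw [pow_add, pow_add, pow_mul, hka, h]
  have hord : orderOf g = q ^ r - 1 := by
    rw [orderOf_eq_card_of_forall_mem_zpowers hg, Nat.card_units, Nat.card_eq_fintype_card, hcard]
  have hdvd : q - 1 ∣ orderOf g := by
    simpa [hord] using Nat.sub_dvd_pow_sub_pow q 1 r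
  have hmod : i + k ≡ j + k * q [MOD q - 1] := (pow_eq_pow_iff_modEq.1 hpow).of_dvd hdvd
  have hq1 : k * q ≡ k [MOD q - 1] := by
    have h1 : q ≡ 1 [MOD q - 1] := ((Nat.modEq_iff_dvd' (by omega)).2 dvd_rfl).symm
    simpa using h1.mul_left k
  have hij' : i ≡ j [MOD q - 1] := (hmod.trans (hq1.add_left j)).add_right_cancel' k
  exact hij.ne (hij'.eq_of_lt_of_lt (by omega) (by omega))
end
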